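/- Let r ∈ (0,1) and suppose p̂, p̌ ∈ (0,1) satisfy 2·E(p̂)/K(p̂) − 1 = r and 1 − 2·E(p̌)/K(p̌) = r. Then K(p̂)·(p̂²·K(p̂) − K(p̂) + E(p̂)) < K(p̌)·(p̌²·K(p̌) − K(p̌) + E(p̌)). (In particular, for every n ≥ 0, the elastic energy of the wavelike elastica γ̂ₙ, which equals (16(n+1)²/L)·K(p̂)·(p̂²·K(p̂) − K(p̂) + E(p̂)), is strictly smaller than that of γ̌ₙ, which equals (16(n+1)²/L)·K(p̌)·(p̌²·K(p̌) − K(p̌) + E(p̌)).) -/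

import Mathlib

/-- Complete elliptic integral of the first kind. -/
noncomputable def ellipticK (p : ℝ) : ℝ :=
  ∫ z in (0:ℝ)..1, 1 / (Real.sqrt (1 - z ^ 2) * Real.sqrt (1 - p ^ 2 * z ^ 2))

/-- Complete elliptic integral of the second kind. -/
noncomputable def ellipticE (p : ℝ) : ℝ :=
  ∫ z in (0:ℝ)..1, Real.sqrt (1 - p ^ 2 * z ^ 2) / Real.sqrt (1 - z ^ 2)

open Set intervalIntegral

lemma one_sub_sq_mul_sq_pos {p z : ℝ} (hp : p ∈ Ioo (0:ℝ) 1) (hz : z ∈ Icc (0:ℝ) 1) :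
    0 < 1 - p ^ 2 * z ^ 2 := by
  have h1 : p ^ 2 < 1 := by nlinarith [hp.1, hp.2]
  have h2 : z ^ 2 ≤ 1 := by nlinarith [hz.1, hz.2]
  nlinarith [sq_nonneg p, sq_nonneg z]

lemma intervalIntegrable_one_div_sqrt_one_sub_sq :
    IntervalIntegrable (fun z : ℝ => 1 / √(1 - z ^ 2)) MeasureTheory.volume 0 1 := by
  apply intervalIntegrable_deriv_of_nonneg (g := Real.arcsin) Real.continuous_arcsin.continuousOn
  · intro z hz
    simp only [zero_le_one, min_eq_left, max_eq_right, mem_Ioo] at hz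
    exact Real.hasDerivAt_arcsin (by linarith) (by linarith)
  · intro z _
    positivity

lemma continuousOn_sqrt_one_sub_sq_mul_sq (p : ℝ) (s : Set ℝ) :
    ContinuousOn (fun z : ℝ => √(1 - p ^ 2 * z ^ 2)) s := by
  fun_prop

lemma intervalIntegrable_ellipticE_integrand (p : ℝ) :
    IntervalIntegrable (fun z : ℝ => √(1 - p ^ 2 * z ^ 2) / √(1 - z ^ 2))
      MeasureTheory.volume 0 1 := by
  convert intervalIntegrable_one_div_sqrt_one_sub_sq.mul_continuousOn
    (continuousOn_sqrt_one_sub_sq_mul_sq p _) using 2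
  ring

lemma intervalIntegrable_ellipticK_integrand {p : ℝ} (hp : p ∈ Ioo (0:ℝ) 1) :
    IntervalIntegrable (fun z : ℝ => 1 / (√(1 - z ^ 2) * √(1 - p ^ 2 * z ^ 2)))
      MeasureTheory.volume 0 1 := by
  have hc : ContinuousOn (fun z : ℝ => (√(1 - p ^ 2 * z ^ 2))⁻¹) (uIcc 0 1) := by
    refine (continuousOn_sqrt_one_sub_sq_mul_sq p _).inv₀ fun z hz => ?_
    rw [uIcc_of_le zero_le_one] at hz
    exact (Real.sqrt_pos.2 (one_sub_sq_mul_sq_pos hp hz)).ne'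
  convert intervalIntegrable_one_div_sqrt_one_sub_sq.mul_continuousOn hc using 2
  rw [one_div, one_div, mul_inv]

lemma ellipticK_pos {p : ℝ} (hp : p ∈ Ioo (0:ℝ) 1) : 0 < ellipticK p := by
  refine intervalIntegral_pos_of_pos_on (intervalIntegrable_ellipticK_integrand hp)
    (fun z hz => ?_) zero_lt_one
  have h1 := Real.sqrt_pos.2 (one_sub_sq_mul_sq_pos hp (Ioo_subset_Icc_self hz))
  have h2 : 0 < √(1 - z ^ 2) := Real.sqrt_pos.2 (by nlinarith [hz.1, hz.2])
  positivity

lemma ellipticK_le_ellipticK {p q : ℝ} (hp : p ∈ Ioo (0:ℝ) 1) (hq : q ∈ Ioo (0:ℝ) 1)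
    (hpq : p ≤ q) : ellipticK p ≤ ellipticK q := by
  refine integral_mono_on_of_le_Ioo zero_le_one (intervalIntegrable_ellipticK_integrand hp)
    (intervalIntegrable_ellipticK_integrand hq) fun z hz => ?_
  have h1 := Real.sqrt_pos.2 (one_sub_sq_mul_sq_pos hq (Ioo_subset_Icc_self hz))
  have h2 : 0 < √(1 - z ^ 2) := Real.sqrt_pos.2 (by nlinarith [hz.1, hz.2])
  have := hp.1
  gcongr

lemma ellipticE_le_ellipticE {p q : ℝ} (hp : 0 ≤ p) (hpq : p ≤ q) :
    ellipticE q ≤ ellipticE p := by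
  refine integral_mono_on zero_le_one (intervalIntegrable_ellipticE_integrand q)
    (intervalIntegrable_ellipticE_integrand p) fun z _ => ?_
  gcongr

lemma sq_mul_ellipticK_sub_ellipticK_add_ellipticE {p : ℝ} (hp : p ∈ Ioo (0:ℝ) 1) :
    p ^ 2 * ellipticK p - ellipticK p + ellipticE p =
      ∫ z in (0:ℝ)..1, p ^ 2 * √(1 - z ^ 2) / √(1 - p ^ 2 * z ^ 2) := by
  have hK := intervalIntegrable_ellipticK_integrand hp
  have hE := intervalIntegrable_ellipticE_integrand p
  have h : p ^ 2 * ellipticK p - ellipticK p + ellipticE p =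
      (p ^ 2 - 1) * ellipticK p + ellipticE p := by ring
  rw [h, ellipticK, ellipticE, ← integral_const_mul, ← integral_add (hK.const_mul _) hE]
  refine integral_congr_Ioo_of_le zero_le_one fun z hz => ?_
  have hA := one_sub_sq_mul_sq_pos hp (Ioo_subset_Icc_self hz)
  have hB : 0 < 1 - z ^ 2 := by nlinarith [hz.1, hz.2]
  have h1 := Real.sqrt_pos.2 hA
  have h2 := Real.sqrt_pos.2 hB
  have h3 := Real.sq_sqrt hA.le
  have h4 := Real.sq_sqrt hB.le
  field_simp
  rw [h3, h4]
  ring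

lemma sq_mul_ellipticK_sub_ellipticK_add_ellipticE_lt {p q : ℝ} (hp : p ∈ Ioo (0:ℝ) 1)
    (hq : q ∈ Ioo (0:ℝ) 1) (hpq : p < q) :
    p ^ 2 * ellipticK p - ellipticK p + ellipticE p <
      q ^ 2 * ellipticK q - ellipticK q + ellipticE q := by
  have hc {t : ℝ} (ht : t ∈ Ioo (0:ℝ) 1) :
      ContinuousOn (fun z : ℝ => t ^ 2 * √(1 - z ^ 2) / √(1 - t ^ 2 * z ^ 2)) (Icc 0 1) :=
    ContinuousOn.div (by fun_prop) (by fun_prop) fun z hz =>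
      (Real.sqrt_pos.2 (one_sub_sq_mul_sq_pos ht hz)).ne'
  have := hp.1
  rw [sq_mul_ellipticK_sub_ellipticK_add_ellipticE hp,
    sq_mul_ellipticK_sub_ellipticK_add_ellipticE hq]
  refine integral_lt_integral_of_continuousOn_of_le_of_exists_lt zero_lt_one (hc hp) (hc hq)
    (fun z hz => ?_) ⟨0, by simp, ?_⟩
  · have h1 := Real.sqrt_pos.2 (one_sub_sq_mul_sq_pos hq (Ioc_subset_Icc_self hz))
    gcongr
  · simpa using pow_lt_pow_left₀ hpq this.le two_ne_zero

lemma sq_mul_ellipticK_sub_ellipticK_add_ellipticE_nonneg {p : ℝ} (hp : p ∈ Ioo (0:ℝ) 1) :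
    0 ≤ p ^ 2 * ellipticK p - ellipticK p + ellipticE p := by
  rw [sq_mul_ellipticK_sub_ellipticK_add_ellipticE hp]
  exact integral_nonneg zero_le_one fun z _ => by positivity

theorem energy_hat_lt_energy_check {r pHat pCheck : ℝ} (hr : r ∈ Set.Ioo (0:ℝ) 1)
    (hpHat : pHat ∈ Set.Ioo (0:ℝ) 1) (hpCheck : pCheck ∈ Set.Ioo (0:ℝ) 1)
    (h1 : 2 * ellipticE pHat / ellipticK pHat - 1 = r)
    (h2 : 1 - 2 * ellipticE pCheck / ellipticK pCheck = r) :
    ellipticK pHat * (pHat ^ 2 * ellipticK pHat - ellipticK pHat + ellipticE pHat) <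
      ellipticK pCheck *
        (pCheck ^ 2 * ellipticK pCheck - ellipticK pCheck + ellipticE pCheck) := by
  have hKHat := ellipticK_pos hpHat
  have hKCheck := ellipticK_pos hpCheck
  have hlt : pHat < pCheck := by
    by_contra! hle
    have hK := ellipticK_le_ellipticK hpCheck hpHat hle
    have hE := ellipticE_le_ellipticE hpCheck.1.le hle
    have e1 : 2 * ellipticE pHat = (1 + r) * ellipticK pHat := by
      rw [← h1]
      field_simp
      ring
    have e2 : 2 * ellipticE pCheck = (1 - r) * ellipticK pCheck := by
      rw [← h2]
      field_simp
      ring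
    nlinarith [hr.1, hr.2]
  exact mul_lt_mul' (ellipticK_le_ellipticK hpHat hpCheck hlt.le)
    (sq_mul_ellipticK_sub_ellipticK_add_ellipticE_lt hpHat hpCheck hlt)
    (sq_mul_ellipticK_sub_ellipticK_add_ellipticE_nonneg hpHat) hKCheck
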